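/- Let d ≥ 2 and let μ be the normalized Haar probability measure on the unitary group U(d) of d × d complex unitary matrices. Let O be a complex d × d matrix with Tr(O) = 0, and let P, σ be complex d × d matrices. Then ∫_{U(d)} (Tr(U† O U · (Pσ − σP)))² dμ(U) = Tr(O²)·Tr((Pσ − σP)²)/(d² − 1). Consequently, the variance of the VSQL gradient ∂o/∂θ = −(i/2)·Tr(U† O U·[P, σ]) over Haar-random U equals −(1/4)·Tr(O²)·Tr([P, σ]²)/(d² − 1). -/

import Mathlib

open Matrix MeasureTheory

theorem exists_perm_apply_eq {n : Type*} [DecidableEq n] {i j k l : n} (hij : i ≠ j) (hkl : k ≠ l) :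
    ∃ τ : Equiv.Perm n, τ i = k ∧ τ j = l := by
  refine ⟨Equiv.swap (Equiv.swap i k j) l * Equiv.swap i k, ?_, by simp⟩
  have h : Equiv.swap i k j ≠ k := fun h => hij <| by
    have := congrArg (Equiv.swap i k) h
    simpa using this.symm
  simp [Equiv.swap_apply_of_ne_of_ne h.symm hkl]

theorem bilin_eq_zero_of_isHermitian {n : Type*}
    {B : Matrix n n ℂ →ₗ[ℂ] Matrix n n ℂ →ₗ[ℂ] ℂ} (hB : ∀ X Y, B X Y = B Y X)
    (h : ∀ X : Matrix n n ℂ, X.IsHermitian → B X X = 0) : B = 0 := by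
  have hH : ∀ X Y : Matrix n n ℂ, X.IsHermitian → Y.IsHermitian → B X Y = 0 := by
    intro X Y hX hY
    have := h (X + Y) (hX.add hY)
    simp only [map_add, LinearMap.add_apply, h X hX, h Y hY, hB Y X] at this
    linear_combination this / 2
  have hdec : ∀ X : Matrix n n ℂ, ∃ H K : Matrix n n ℂ, H.IsHermitian ∧ K.IsHermitian ∧
      X = H + Complex.I • K := fun X =>
    ⟨realPart X, imaginaryPart X, (realPart X).2, (imaginaryPart X).2,
      (realPart_add_I_smul_imaginaryPart X).symm⟩
  refine LinearMap.ext fun X => LinearMap.ext fun Y => ?_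
  obtain ⟨H, K, hH₀, hK, rfl⟩ := hdec X
  obtain ⟨L, M, hL, hM, rfl⟩ := hdec Y
  simp [hH _ _ hH₀ hL, hH _ _ hH₀ hM, hH _ _ hK hL, hH _ _ hK hM]

section InvariantForm

variable {n : Type*} [Fintype n] [DecidableEq n]

/-- A complex bilinear map on matrices is unchanged by unitary conjugation of both arguments. -/
def IsConjInvariant (B : Matrix n n ℂ →ₗ[ℂ] Matrix n n ℂ →ₗ[ℂ] ℂ) : Prop :=
  ∀ V ∈ unitaryGroup n ℂ, ∀ X Y, B (Vᴴ * X * V) (Vᴴ * Y * V) = B X Y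

theorem permMatrix_mem_unitaryGroup (τ : Equiv.Perm n) :
    τ.permMatrix ℂ ∈ unitaryGroup n ℂ := by
  rw [mem_unitaryGroup_iff', star_eq_conjTranspose, conjTranspose_permMatrix, ← permMatrix_mul]
  simp

theorem permMatrix_conj_single (τ : Equiv.Perm n) (i : n) :
    (τ.permMatrix ℂ)ᴴ * single i i (1 : ℂ) * τ.permMatrix ℂ = single (τ i) (τ i) 1 := by
  rw [conjTranspose_permMatrix, PEquiv.toMatrix_toPEquiv_mul, PEquiv.mul_toMatrix_toPEquiv,
    submatrix_submatrix]
  exact submatrix_single_equiv τ.symm τ.symm i i 1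

variable {B : Matrix n n ℂ →ₗ[ℂ] Matrix n n ℂ →ₗ[ℂ] ℂ}

/-- A symmetric conjugation-invariant form is determined by its values on diagonal matrix units. -/
theorem IsConjInvariant.eq_zero (hinv : IsConjInvariant B) (hB : ∀ X Y, B X Y = B Y X)
    (h : ∀ i j, B (single i i 1) (single j j 1) = 0) : B = 0 := by
  refine bilin_eq_zero_of_isHermitian hB fun X hX => ?_
  have hdiag : ∀ v : n → ℂ, B (diagonal v) (diagonal v) = 0 := by
    intro v
    have hv : diagonal v = ∑ i, v i • single i i (1 : ℂ) := by
      simp [← sum_single_eq_diagonal]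
    rw [hv]
    simp only [map_sum, map_smul, LinearMap.sum_apply, LinearMap.smul_apply, h, smul_zero,
      Finset.sum_const_zero]
  have := hinv (star (hX.eigenvectorUnitary : Matrix n n ℂ)) (star hX.eigenvectorUnitary).2
    (diagonal (RCLike.ofReal ∘ hX.eigenvalues)) (diagonal (RCLike.ofReal ∘ hX.eigenvalues))
  rw [hdiag] at this
  have hs := hX.spectral_theorem
  rw [Unitary.conjStarAlgAut_apply] at hs
  rw [star_eq_conjTranspose, conjTranspose_conjTranspose, ← star_eq_conjTranspose, ← hs] at this
  exact this

/-- The invariant form `a Tr(XY) + b Tr(X) Tr(Y)`. -/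
noncomputable def traceForm (a b : ℂ) : Matrix n n ℂ →ₗ[ℂ] Matrix n n ℂ →ₗ[ℂ] ℂ :=
  LinearMap.mk₂ ℂ (fun X Y => a * (X * Y).trace + b * (X.trace * Y.trace))
    (fun X X' Y => by simp only [add_mul, trace_add]; ring)
    (fun c X Y => by simp only [smul_mul, trace_smul, smul_eq_mul]; ring)
    (fun X Y Y' => by simp only [mul_add, trace_add]; ring)
    (fun c X Y => by simp only [Matrix.mul_smul, trace_smul, smul_eq_mul]; ring)

@[simp]
theorem traceForm_apply (a b : ℂ) (X Y : Matrix n n ℂ) :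
    traceForm a b X Y = a * (X * Y).trace + b * (X.trace * Y.trace) := rfl

theorem trace_conj_of_mem_unitaryGroup {V : Matrix n n ℂ} (hV : V ∈ unitaryGroup n ℂ)
    (X : Matrix n n ℂ) : (Vᴴ * X * V).trace = X.trace := by
  rw [mul_assoc, trace_mul_comm, mul_assoc, ← star_eq_conjTranspose, mem_unitaryGroup_iff.1 hV,
    mul_one]

theorem isConjInvariant_traceForm (a b : ℂ) : IsConjInvariant (traceForm (n := n) a b) := by
  intro V hV X Y
  have h : Vᴴ * X * V * (Vᴴ * Y * V) = Vᴴ * (X * Y) * V := by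
    have hVV : V * Vᴴ = 1 := mem_unitaryGroup_iff.1 hV
    calc Vᴴ * X * V * (Vᴴ * Y * V) = Vᴴ * X * (V * Vᴴ) * Y * V := by simp only [mul_assoc]
      _ = Vᴴ * (X * Y) * V := by rw [hVV]; simp only [mul_assoc, mul_one]
  simp [h, trace_conj_of_mem_unitaryGroup hV]

theorem IsConjInvariant.exists_eq_traceForm [Nontrivial n] (hinv : IsConjInvariant B)
    (hB : ∀ X Y, B X Y = B Y X) : ∃ a b, B = traceForm a b := by
  obtain ⟨p, q, hpq⟩ := exists_pair_ne n
  have hperm : ∀ (τ : Equiv.Perm n) (i j : n), B (single (τ i) (τ i) 1) (single (τ j) (τ j) 1) =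
      B (single i i 1) (single j j 1) := by
    intro τ i j
    simp_rw [← permMatrix_conj_single τ]
    exact hinv _ (permMatrix_mem_unitaryGroup τ) _ _
  refine ⟨B (single p p 1) (single p p 1) - B (single p p 1) (single q q 1),
    B (single p p 1) (single q q 1), sub_eq_zero.1 (IsConjInvariant.eq_zero ?_ ?_ ?_)⟩
  · intro V hV X Y
    simp only [LinearMap.sub_apply, hinv V hV X Y, isConjInvariant_traceForm _ _ V hV X Y]
  · intro X Y
    simp only [LinearMap.sub_apply, hB X Y, traceForm_apply, trace_mul_comm X Y,
      mul_comm X.trace]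
  · intro i j
    rcases eq_or_ne i j with rfl | hij
    · have := hperm (Equiv.swap p i) p p
      rw [Equiv.swap_apply_left] at this
      simp [this]
    · obtain ⟨τ, rfl, rfl⟩ := exists_perm_apply_eq hpq hij
      simp [hperm, hij]

theorem sum_trace_single_mul_mul_trace_single_mul (M : Matrix n n ℂ) :
    ∑ i, ∑ j, (single i j 1 * M).trace * (single j i 1 * M).trace = (M * M).trace := by
  simp only [trace_single_mul, one_smul]
  simp only [Matrix.trace, diag_apply, Matrix.mul_apply]
  rw [Finset.sum_comm]

end InvariantForm

section Haar

variable {n : Type*} [Fintype n] [DecidableEq n]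

instance compactSpace_unitaryGroup : CompactSpace (unitaryGroup n ℂ) := by
  refine isCompact_iff_compactSpace.1 (IsCompact.of_isClosed_subset
    (isCompact_univ_pi fun _ : n => isCompact_univ_pi fun _ : n =>
      isCompact_closedBall (0 : ℂ) 1) (isClosed_unitary (R := Matrix n n ℂ)) ?_)
  intro U hU i _ j _
  simpa using entry_norm_bound_of_unitary hU i j

variable [MeasurableSpace (unitaryGroup n ℂ)] [BorelSpace (unitaryGroup n ℂ)]
  (μ : Measure (unitaryGroup n ℂ))

theorem integrable_trace_conj_mul_mul [IsFiniteMeasure μ] (C X Y : Matrix n n ℂ) :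
    Integrable (fun U : unitaryGroup n ℂ =>
      ((U : Matrix n n ℂ)ᴴ * X * (U : Matrix n n ℂ) * C).trace *
        ((U : Matrix n n ℂ)ᴴ * Y * (U : Matrix n n ℂ) * C).trace) μ :=
  Continuous.integrable_of_hasCompactSupport (by fun_prop) (HasCompactSupport.of_compactSpace _)

/-- The second moment form `(X, Y) ↦ ∫ Tr(U† X U C) Tr(U† Y U C) dμ(U)`. -/
noncomputable def momentForm [IsFiniteMeasure μ] (C : Matrix n n ℂ) :
    Matrix n n ℂ →ₗ[ℂ] Matrix n n ℂ →ₗ[ℂ] ℂ :=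
  have hint := integrable_trace_conj_mul_mul μ C
  LinearMap.mk₂ ℂ (fun X Y => ∫ U : unitaryGroup n ℂ,
      ((U : Matrix n n ℂ)ᴴ * X * (U : Matrix n n ℂ) * C).trace *
        ((U : Matrix n n ℂ)ᴴ * Y * (U : Matrix n n ℂ) * C).trace ∂μ)
    (fun X X' Y => by
      rw [← integral_add (hint X Y) (hint X' Y)]
      simp only [mul_add, add_mul, trace_add])
    (fun c X Y => by
      rw [← integral_smul]
      simp only [Matrix.mul_smul, trace_smul, smul_mul_assoc])
    (fun X Y Y' => by
      rw [← integral_add (hint X Y) (hint X Y')]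
      simp only [mul_add, add_mul, trace_add])
    (fun c X Y => by
      rw [← integral_smul]
      simp only [Matrix.smul_mul, trace_smul, mul_smul_comm])

theorem momentForm_apply [IsFiniteMeasure μ] (C X Y : Matrix n n ℂ) :
    momentForm μ C X Y = ∫ U : unitaryGroup n ℂ,
      ((U : Matrix n n ℂ)ᴴ * X * (U : Matrix n n ℂ) * C).trace *
        ((U : Matrix n n ℂ)ᴴ * Y * (U : Matrix n n ℂ) * C).trace ∂μ := rfl

theorem momentForm_comm [IsFiniteMeasure μ] (C X Y : Matrix n n ℂ) :
    momentForm μ C X Y = momentForm μ C Y X := by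
  simp only [momentForm_apply, mul_comm]

theorem isConjInvariant_momentForm [IsFiniteMeasure μ] [μ.IsMulLeftInvariant]
    (C : Matrix n n ℂ) : IsConjInvariant (momentForm μ C) := by
  intro V hV X Y
  rw [momentForm_apply, momentForm_apply]
  refine Eq.trans ?_ (integral_mul_left_eq_self _ (⟨V, hV⟩ : unitaryGroup n ℂ))
  simp only [Submonoid.coe_mul, conjTranspose_mul, mul_assoc]

theorem momentForm_one_left [IsFiniteMeasure μ] {C : Matrix n n ℂ} (hC : C.trace = 0)
    (Y : Matrix n n ℂ) : momentForm μ C 1 Y = 0 := by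
  have h (U : unitaryGroup n ℂ) : (U : Matrix n n ℂ)ᴴ * (U : Matrix n n ℂ) = 1 :=
    mem_unitaryGroup_iff'.1 U.2
  simp [momentForm_apply, h, hC]

theorem sum_momentForm_single [IsProbabilityMeasure μ] (C : Matrix n n ℂ) :
    ∑ i, ∑ j, momentForm μ C (single i j 1) (single j i 1) = (C * C).trace := by
  have hint := integrable_trace_conj_mul_mul μ C
  simp only [momentForm_apply]
  have hrow (i : n) := integral_finsetSum (μ := μ) Finset.univ fun j _ =>
    hint (single i j 1) (single j i 1)
  simp_rw [← hrow]
  rw [← integral_finsetSum Finset.univ fun i _ => integrable_finsetSum Finset.univ fun j _ =>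
    hint (single i j 1) (single j i 1)]
  have h (U : unitaryGroup n ℂ) : ∑ i, ∑ j,
      ((U : Matrix n n ℂ)ᴴ * single i j 1 * (U : Matrix n n ℂ) * C).trace *
        ((U : Matrix n n ℂ)ᴴ * single j i 1 * (U : Matrix n n ℂ) * C).trace =
      (C * C).trace := by
    have hcyc (X : Matrix n n ℂ) : ((U : Matrix n n ℂ)ᴴ * X * (U : Matrix n n ℂ) * C).trace =
        (X * ((U : Matrix n n ℂ) * C * (U : Matrix n n ℂ)ᴴ)).trace := by
      rw [mul_assoc, mul_assoc, trace_mul_comm]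
      simp only [mul_assoc]
    simp_rw [hcyc, sum_trace_single_mul_mul_trace_single_mul]
    have := isConjInvariant_traceForm 1 0 _ (star U).2 C C
    simpa [star_eq_conjTranspose] using this
  simp [h]

/-- The second moment of `Tr(U† X U C)` for traceless `X` and `C`. -/
theorem integral_sq_trace_conj_mul [Nontrivial n] [IsProbabilityMeasure μ]
    [μ.IsMulLeftInvariant] {X C : Matrix n n ℂ} (hX : X.trace = 0) (hC : C.trace = 0) :
    ∫ U : unitaryGroup n ℂ, ((U : Matrix n n ℂ)ᴴ * X * (U : Matrix n n ℂ) * C).trace ^ 2 ∂μ =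
      (X * X).trace * (C * C).trace / ((Fintype.card n : ℂ) ^ 2 - 1) := by
  obtain ⟨a, b, hab⟩ := (isConjInvariant_momentForm μ C).exists_eq_traceForm (momentForm_comm μ C)
  have hone := momentForm_one_left μ hC (1 : Matrix n n ℂ)
  have hsum := sum_momentForm_single μ C
  have hXX := momentForm_apply μ C X X
  simp only [hab, traceForm_apply, hX] at hone hsum hXX
  have hcard : (1 : ℝ) < Fintype.card n := by exact_mod_cast Fintype.one_lt_card
  have hd : (Fintype.card n : ℂ) ≠ 0 := by simp
  have hd2 : (Fintype.card n : ℂ) ^ 2 - 1 ≠ 0 := by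
    have : (Fintype.card n : ℝ) ^ 2 - 1 ≠ 0 := by nlinarith
    exact_mod_cast this
  have hab0 : a + b * Fintype.card n = 0 := by
    simp only [mul_one, trace_one] at hone
    exact (mul_eq_zero.1 (by linear_combination hone :
      (Fintype.card n : ℂ) * (a + b * Fintype.card n) = 0)).resolve_left hd
  have hsum' : a * (Fintype.card n : ℂ) ^ 2 + b * Fintype.card n = (C * C).trace := by
    rw [← hsum]
    have hs (i j : n) : (single i j (1 : ℂ)).trace * (single j i 1).trace =
        if i = j then 1 else 0 := by
      split_ifs with hij
      · simp [hij]
      · simp [trace_single_eq_of_ne _ _ _ hij]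
    simp only [hs, Finset.sum_add_distrib, ← Finset.mul_sum]
    simp [sq]
  simp_rw [sq (trace _)]
  rw [← hXX, eq_div_iff hd2, ← hsum']
  linear_combination (-(X * X).trace) * hab0

end Haar

theorem stmt_8 (d : ℕ) (hd : 2 ≤ d)
    [MeasurableSpace (Matrix.unitaryGroup (Fin d) ℂ)]
    [BorelSpace (Matrix.unitaryGroup (Fin d) ℂ)]
    (μ : Measure (Matrix.unitaryGroup (Fin d) ℂ))
    [μ.IsHaarMeasure] [IsProbabilityMeasure μ]
    (O P σ : Matrix (Fin d) (Fin d) ℂ) (hO : O.trace = 0) :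
    (∫ U : Matrix.unitaryGroup (Fin d) ℂ,
        (((U : Matrix (Fin d) (Fin d) ℂ)ᴴ * O * (U : Matrix (Fin d) (Fin d) ℂ) *
          (P * σ - σ * P)).trace) ^ 2 ∂μ
      = (O * O).trace * ((P * σ - σ * P) * (P * σ - σ * P)).trace / ((d : ℂ) ^ 2 - 1)) ∧
    (∫ U : Matrix.unitaryGroup (Fin d) ℂ,
        ((-(Complex.I) / 2) *
          ((U : Matrix (Fin d) (Fin d) ℂ)ᴴ * O * (U : Matrix (Fin d) (Fin d) ℂ) *
            (P * σ - σ * P)).trace) ^ 2 ∂μ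
      = -(1 / 4) * (O * O).trace * ((P * σ - σ * P) * (P * σ - σ * P)).trace /
          ((d : ℂ) ^ 2 - 1)) := by
  have hn : Nontrivial (Fin d) := Fin.nontrivial_iff_two_le.2 hd
  have hC : (P * σ - σ * P).trace = 0 := by rw [trace_sub, trace_mul_comm, sub_self]
  have h := integral_sq_trace_conj_mul μ hO hC
  rw [Fintype.card_fin] at h
  refine ⟨h, ?_⟩
  simp_rw [mul_pow]
  rw [integral_const_mul, h, div_pow, neg_sq, Complex.I_sq]
  ring
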